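/- arXiv:2510.15097 — 2 statements merged into one kernel-verified Lean document; each statement's English description precedes it below -/
import Mathlib

section
/- Let X be a real normed vector space and g : X → X a contraction with rate ρ < 1, i.e. ‖g(x) − g(y)‖ ≤ ρ‖x − y‖ for all x, y, and let x* satisfy x* = g(x*). Given points x_1, …, x_m ∈ X with residuals r_i = x_i − g(x_i), and coefficients α_i ≥ 0 with Σ_{i=1}^m α_i = 1, the convex-combination update x⁺ = Σ_{i=1}^m α_i x_i satisfies ‖x⁺ − x*‖ ≤ ρ · max_{1≤i≤m} ‖x_i − x*‖ + ‖Σ_{i=1}^m α_i r_i‖. -/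
/-- Convergence estimate for the convex-combination (Anderson/ROM) update of a
`ρ`-contraction `g` with fixed point `x*`:
`‖∑ α_i x_i − x*‖ ≤ ρ · max_i ‖x_i − x*‖ + ‖∑ α_i r_i‖` where `r_i = x_i − g x_i`. -/
theorem anderson_contraction_estimate {X : Type*} [NormedAddCommGroup X]
    [NormedSpace ℝ X] (g : X → X) (ρ : ℝ) (hρ : ρ < 1)
    (hg : ∀ x y, ‖g x - g y‖ ≤ ρ * ‖x - y‖)
    (xstar : X) (hfix : xstar = g xstar)
    (m : ℕ) [NeZero m] (x : Fin m → X) (r : Fin m → X)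
    (hr : ∀ i, r i = x i - g (x i))
    (α : Fin m → ℝ) (hα : ∀ i, 0 ≤ α i) (hsum : ∑ i, α i = 1) :
    ‖(∑ i, α i • x i) - xstar‖ ≤
      ρ * (Finset.univ.sup' Finset.univ_nonempty fun i => ‖x i - xstar‖) +
        ‖∑ i, α i • r i‖ := by
  set M := Finset.univ.sup' Finset.univ_nonempty fun i => ‖x i - xstar‖ with hM
  have hle : ∀ i, ‖x i - xstar‖ ≤ M := fun i =>
    Finset.le_sup' (fun i => ‖x i - xstar‖) (Finset.mem_univ i)
  have hbound : ∀ i, ‖g (x i) - xstar‖ ≤ ρ * M := by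
    intro i
    have hgi : ‖g (x i) - xstar‖ ≤ ρ * ‖x i - xstar‖ := by
      simpa only [← hfix] using hg (x i) xstar
    rcases le_or_gt 0 ρ with hρ0 | hρ0
    · exact hgi.trans (mul_le_mul_of_nonneg_left (hle i) hρ0)
    · -- a negative rate forces all distances to vanish
      have hzero : ∀ j, ‖x j - xstar‖ = 0 := fun j => by
        have := (norm_nonneg _).trans (hg (x j) xstar)
        nlinarith [norm_nonneg (x j - xstar)]
      have hM0 : M = 0 := by simp [hM, hzero]
      rwa [hM0, ← hzero i]
  have hsplit : (∑ i, α i • x i) - xstar =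
      ∑ i, α i • (g (x i) - xstar) + ∑ i, α i • r i := by
    simp only [hr, smul_sub, Finset.sum_sub_distrib, ← Finset.sum_smul, hsum, one_smul]
    abel
  rw [hsplit]
  refine (norm_add_le _ _).trans (add_le_add_left ?_ _)
  calc ‖∑ i, α i • (g (x i) - xstar)‖ ≤ ∑ i, α i * (ρ * M) :=
        norm_sum_le_of_le _ fun i _ => by
          rw [norm_smul, Real.norm_of_nonneg (hα i)]
          exact mul_le_mul_of_nonneg_left (hbound i) (hα i)
    _ = ρ * M := by rw [← Finset.sum_mul, hsum, one_mul]
end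

section
/- Let E be a real inner product space and φ : ℝ → ℝ a convex, differentiable, nondecreasing function. Then the vector field a ↦ φ′(‖a‖²) a on E is monotone: for all a, b ∈ E, ⟨φ′(‖a‖²) a − φ′(‖b‖²) b, a − b⟩ ≥ 0. -/
open RealInnerProductSpace

theorem real_inner_smul_sub_smul_sub {E : Type*} [NormedAddCommGroup E]
    [InnerProductSpace ℝ E] (p q : ℝ) (a b : E) :
    ⟪p • a - q • b, a - b⟫ =
      ((p + q) * ‖a - b‖ ^ 2 + (p - q) * (‖a‖ ^ 2 - ‖b‖ ^ 2)) / 2 := by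
  rw [norm_sub_sq_real]
  simp only [inner_sub_left, inner_sub_right, real_inner_smul_left,
    real_inner_self_eq_norm_sq, real_inner_comm a b]
  ring

/-- For a convex, differentiable, nondecreasing `φ : ℝ → ℝ`, the vector field
`a ↦ φ′(‖a‖²) a` on a real inner product space is monotone. -/
theorem gradient_field_monotone {E : Type*} [NormedAddCommGroup E]
    [InnerProductSpace ℝ E] (φ : ℝ → ℝ) (hconv : ConvexOn ℝ Set.univ φ)
    (hdiff : Differentiable ℝ φ) (hmono : Monotone φ) :
    ∀ a b : E, 0 ≤ ⟪deriv φ (‖a‖ ^ 2) • a - deriv φ (‖b‖ ^ 2) • b, a - b⟫ := by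
  intro a b
  have hderiv : Monotone (deriv φ) :=
    monotoneOn_univ.mp (hconv.monotoneOn_deriv fun x _ => hdiff x)
  have hcross : 0 ≤ (deriv φ (‖a‖ ^ 2) - deriv φ (‖b‖ ^ 2)) * (‖a‖ ^ 2 - ‖b‖ ^ 2) := by
    rcases le_total (‖a‖ ^ 2) (‖b‖ ^ 2) with h | h
    · exact mul_nonneg_of_nonpos_of_nonpos (sub_nonpos.mpr (hderiv h)) (sub_nonpos.mpr h)
    · exact mul_nonneg (sub_nonneg.mpr (hderiv h)) (sub_nonneg.mpr h)
  have ha : 0 ≤ deriv φ (‖a‖ ^ 2) := hmono.deriv_nonneg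
  have hb : 0 ≤ deriv φ (‖b‖ ^ 2) := hmono.deriv_nonneg
  rw [real_inner_smul_sub_smul_sub]
  positivity
end
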